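/- Under the elliptic projective Lelieuvre relations, the compatibility conditions hold: if at a point p ∈ ℝ² one has det(ν,ν_x,ν_y,ν_{xx})(p) ≠ 0, then ν_{xy}(p) and (ν_{yy} − ν_{xx})(p) lie in the linear span of {ν(p), ν_x(p), ν_y(p)}, and f_{xy}(p) and (f_{yy} − f_{xx})(p) lie in the linear span of {f(p), f_x(p), f_y(p)}. -/

import Mathlib

noncomputable section

/-- Euclidean pairing on `ℝ⁴`. -/
def dot4 (a b : Fin 4 → ℝ) : ℝ := ∑ i, a i * b i

/-- Determinant of the 4×4 matrix with rows `a, b, c, d`. -/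
def det4 (a b c d : Fin 4 → ℝ) : ℝ := Matrix.det (Matrix.of ![a, b, c, d])

/-- Partial derivative in the first (`x`) variable. -/
def dx (g : ℝ × ℝ → Fin 4 → ℝ) : ℝ × ℝ → Fin 4 → ℝ := fun p => fderiv ℝ g p (1, 0)

/-- Partial derivative in the second (`y`) variable. -/
def dy (g : ℝ × ℝ → Fin 4 → ℝ) : ℝ × ℝ → Fin 4 → ℝ := fun p => fderiv ℝ g p (0, 1)

theorem dot4_eq_dotProduct (a b : Fin 4 → ℝ) : dot4 a b = a ⬝ᵥ b := rfl

theorem dot4_comm (a b : Fin 4 → ℝ) : dot4 a b = dot4 b a := dotProduct_comm a b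

theorem eq_zero_of_forall_dot4_eq_zero {a : Fin 4 → ℝ} (h : ∀ z, dot4 z a = 0) : a = 0 :=
  dotProduct_self_eq_zero.mp (h a)

theorem det4_first_eq_third (a b c : Fin 4 → ℝ) : det4 a b a c = 0 :=
  Matrix.det_zero_of_row_eq (i := 0) (j := 2) (by decide) rfl

theorem det4_first_eq_fourth (a b c : Fin 4 → ℝ) : det4 a b c a = 0 :=
  Matrix.det_zero_of_row_eq (i := 0) (j := 3) (by decide) rfl

theorem det4_swap_first_fourth (a b c d : Fin 4 → ℝ) : det4 d b c a = -det4 a b c d := by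
  simp [det4, Matrix.det_succ_row_zero, Fin.sum_univ_succ, Fin.succAbove]
  ring

/-- Four vectors orthogonal to a common nonzero vector have vanishing determinant. -/
theorem det4_eq_zero_of_orthogonal {a b c d u : Fin 4 → ℝ} (hu : u ≠ 0)
    (ha : dot4 a u = 0) (hb : dot4 b u = 0) (hc : dot4 c u = 0) (hd : dot4 d u = 0) :
    det4 a b c d = 0 := by
  refine Matrix.exists_mulVec_eq_zero_iff.mp ⟨u, hu, ?_⟩
  ext i
  fin_cases i <;> assumption

/-- If `a ≠ 0`, `b`, `c` lie in the hyperplane orthogonal to `u ≠ 0`, and the vectors `q`, `r`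
annihilate `a` and separate `b` from `c`, then `a`, `b`, `c` span that hyperplane. -/
theorem mem_span_of_orthogonal {a b c u v q r : Fin 4 → ℝ} (hu : u ≠ 0) (ha0 : a ≠ 0)
    (ha : dot4 a u = 0) (hb : dot4 b u = 0) (hc : dot4 c u = 0) (hv : dot4 v u = 0)
    (haq : dot4 a q = 0) (hbq : dot4 b q ≠ 0) (hcq : dot4 c q = 0)
    (har : dot4 a r = 0) (hbr : dot4 b r = 0) (hcr : dot4 c r ≠ 0) :
    v ∈ Submodule.span ℝ ({a, b, c} : Set (Fin 4 → ℝ)) := by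
  have hdet := det4_eq_zero_of_orthogonal hu hv ha hb hc
  obtain ⟨t, ht0, ht⟩ := Matrix.exists_vecMul_eq_zero_iff.mpr hdet
  have hcomb : t 0 • v + t 1 • a + t 2 • b + t 3 • c = 0 := by
    ext i
    have := congrFun ht i
    simpa [Matrix.vecMul, dotProduct, Fin.sum_univ_four] using this
  have h0 : t 0 ≠ 0 := by
    intro h0
    rw [h0, zero_smul, zero_add] at hcomb
    have pair (s : Fin 4 → ℝ) : t 1 * dot4 a s + t 2 * dot4 b s + t 3 * dot4 c s = 0 := by
      simpa [dot4_eq_dotProduct, add_dotProduct] using congrArg (dot4 · s) hcomb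
    have h2 : t 2 = 0 := by simpa [haq, hcq, hbq] using pair q
    have h3 : t 3 = 0 := by simpa [har, hbr, hcr] using pair r
    have h1 : t 1 = 0 := by simpa [h2, h3, ha0] using hcomb
    exact ht0 (by ext i; fin_cases i <;> assumption)
  have hmem : t 0 • v ∈ Submodule.span ℝ ({a, b, c} : Set (Fin 4 → ℝ)) := by
    rw [Submodule.mem_span_triple]
    refine ⟨-t 1, -t 2, -t 3, ?_⟩
    linear_combination (norm := module) (-1 : ℝ) • hcomb
  exact (Submodule.smul_mem_iff _ h0).mp hmem

theorem dot4_fderiv_add {g h : ℝ × ℝ → Fin 4 → ℝ} (hg : Differentiable ℝ g)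
    (hh : Differentiable ℝ h) (hgh : ∀ p, dot4 (g p) (h p) = 0) (p v : ℝ × ℝ) :
    dot4 (fderiv ℝ g p v) (h p) + dot4 (g p) (fderiv ℝ h p v) = 0 := by
  have hd : HasFDerivAt (fun p => ∑ i, g p i * h p i) _ p :=
    HasFDerivAt.fun_sum fun i _ =>
      (hasFDerivAt_pi'.mp (hg p).hasFDerivAt i).mul (hasFDerivAt_pi'.mp (hh p).hasFDerivAt i)
  have hz : (fun p => ∑ i, g p i * h p i) = fun _ => (0 : ℝ) := funext hgh
  rw [hz] at hd
  have := DFunLike.congr_fun (hd.unique (hasFDerivAt_const 0 p)) v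
  simp only [Fin.sum_univ_four, add_apply, smul_apply,
    ContinuousLinearMap.comp_apply, ContinuousLinearMap.proj_apply, smul_eq_mul,
    zero_apply] at this
  simp only [dot4, Fin.sum_univ_four]
  linear_combination this

theorem differentiable_fderiv_apply {g : ℝ × ℝ → Fin 4 → ℝ} (hg : ContDiff ℝ (⊤ : ℕ∞) g)
    (v : ℝ × ℝ) : Differentiable ℝ fun p => fderiv ℝ g p v :=
  ((hg.fderiv_right (m := 1) (by norm_cast)).differentiable (by norm_num)).clm_apply
    (differentiable_const v)

theorem stmt11 (f ν : ℝ × ℝ → Fin 4 → ℝ)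
    (hsf : ContDiff ℝ (⊤ : ℕ∞) f) (hsν : ContDiff ℝ (⊤ : ℕ∞) ν)
    (hpair : ∀ p, dot4 (f p) (ν p) = 0)
    (hLx : ∀ p, ∀ w z : Fin 4 → ℝ,
      dot4 w (f p) * dot4 z (dx f p) - dot4 z (f p) * dot4 w (dx f p)
        = - det4 w z (ν p) (dy ν p))
    (hLy : ∀ p, ∀ w z : Fin 4 → ℝ,
      dot4 w (f p) * dot4 z (dy f p) - dot4 z (f p) * dot4 w (dy f p)
        = det4 w z (ν p) (dx ν p))
    (hf0 : ∀ p, f p ≠ 0) (hν0 : ∀ p, ν p ≠ 0) :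
    ∀ p : ℝ × ℝ, det4 (ν p) (dx ν p) (dy ν p) (dx (dx ν) p) ≠ 0 →
      dy (dx ν) p ∈ Submodule.span ℝ ({ν p, dx ν p, dy ν p} : Set (Fin 4 → ℝ)) ∧
      dy (dy ν) p - dx (dx ν) p
        ∈ Submodule.span ℝ ({ν p, dx ν p, dy ν p} : Set (Fin 4 → ℝ)) ∧
      dy (dx f) p ∈ Submodule.span ℝ ({f p, dx f p, dy f p} : Set (Fin 4 → ℝ)) ∧
      dy (dy f) p - dx (dx f) p
        ∈ Submodule.span ℝ ({f p, dx f p, dy f p} : Set (Fin 4 → ℝ)) := by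
  have hdf : Differentiable ℝ f := hsf.differentiable (by simp)
  have hdν : Differentiable ℝ ν := hsν.differentiable (by simp)
  have hdfx : Differentiable ℝ (dx f) := differentiable_fderiv_apply hsf _
  have hdfy : Differentiable ℝ (dy f) := differentiable_fderiv_apply hsf _
  have hdνx : Differentiable ℝ (dx ν) := differentiable_fderiv_apply hsν _
  have hdνy : Differentiable ℝ (dy ν) := differentiable_fderiv_apply hsν _
  have cancel {p : ℝ × ℝ} {c : ℝ} (h : ∀ z, dot4 z (f p) * c = 0) : c = 0 := by
    by_contra hc
    exact hf0 p (eq_zero_of_forall_dot4_eq_zero fun z =>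
      (mul_eq_zero.mp (h z)).resolve_right hc)
  have hνf (p) : dot4 (ν p) (f p) = 0 := dot4_comm _ _ ▸ hpair p
  have hνfx (p) : dot4 (ν p) (dx f p) = 0 := cancel fun z => by
    have := hLx p (ν p) z
    rw [det4_first_eq_third, hνf] at this
    linarith
  have hνfy (p) : dot4 (ν p) (dy f p) = 0 := cancel fun z => by
    have := hLy p (ν p) z
    rw [det4_first_eq_third, hνf] at this
    linarith
  have hνxf (p) : dot4 (dx ν p) (f p) = 0 := by
    have : dot4 (dx ν p) (f p) + dot4 (ν p) (dx f p) = 0 := dot4_fderiv_add hdν hdf hνf p _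
    linarith [hνfx p]
  have hνyf (p) : dot4 (dy ν p) (f p) = 0 := by
    have : dot4 (dy ν p) (f p) + dot4 (ν p) (dy f p) = 0 := dot4_fderiv_add hdν hdf hνf p _
    linarith [hνfy p]
  have hνyfx (p) : dot4 (dy ν p) (dx f p) = 0 := cancel fun z => by
    have := hLx p (dy ν p) z
    rw [det4_first_eq_fourth, hνyf] at this
    linarith
  have hνxfy (p) : dot4 (dx ν p) (dy f p) = 0 := cancel fun z => by
    have := hLy p (dx ν p) z
    rw [det4_first_eq_fourth, hνxf] at this
    linarith
  have hdiag (p) : dot4 (dy ν p) (dy f p) = dot4 (dx ν p) (dx f p) :=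
    sub_eq_zero.mp <| cancel fun z => by
      have hx := hLx p (dx ν p) z
      have hy := hLy p (dy ν p) z
      rw [hνxf] at hx
      rw [hνyf, det4_swap_first_fourth] at hy
      linarith
  intro p hdet
  have hνxyf : dot4 (dy (dx ν) p) (f p) + dot4 (dx ν p) (dy f p) = 0 :=
    dot4_fderiv_add hdνx hdf hνxf p _
  have hνxxf : dot4 (dx (dx ν) p) (f p) + dot4 (dx ν p) (dx f p) = 0 :=
    dot4_fderiv_add hdνx hdf hνxf p _
  have hνyyf : dot4 (dy (dy ν) p) (f p) + dot4 (dy ν p) (dy f p) = 0 :=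
    dot4_fderiv_add hdνy hdf hνyf p _
  have hfxyν : dot4 (dy ν p) (dx f p) + dot4 (ν p) (dy (dx f) p) = 0 :=
    dot4_fderiv_add hdν hdfx hνfx p _
  have hfxxν : dot4 (dx ν p) (dx f p) + dot4 (ν p) (dx (dx f) p) = 0 :=
    dot4_fderiv_add hdν hdfx hνfx p _
  have hfyyν : dot4 (dy ν p) (dy f p) + dot4 (ν p) (dy (dy f) p) = 0 :=
    dot4_fderiv_add hdν hdfy hνfy p _
  have hne : dot4 (dx ν p) (dx f p) ≠ 0 := fun h =>
    hdet (det4_eq_zero_of_orthogonal (hf0 p) (hνf p) (hνxf p) (hνyf p) (by linarith))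
  have hne' : dot4 (dy ν p) (dy f p) ≠ 0 := hdiag p ▸ hne
  have spanν {v : Fin 4 → ℝ} (hv : dot4 v (f p) = 0) :
      v ∈ Submodule.span ℝ ({ν p, dx ν p, dy ν p} : Set (Fin 4 → ℝ)) :=
    mem_span_of_orthogonal (hf0 p) (hν0 p) (hνf p) (hνxf p) (hνyf p) hv
      (hνfx p) hne (hνyfx p) (hνfy p) (hνxfy p) hne'
  have spanf {v : Fin 4 → ℝ} (hv : dot4 (ν p) v = 0) :
      v ∈ Submodule.span ℝ ({f p, dx f p, dy f p} : Set (Fin 4 → ℝ)) := by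
    refine mem_span_of_orthogonal (u := ν p) (q := dx ν p) (r := dy ν p) (hν0 p) (hf0 p)
      ?_ ?_ ?_ ?_ ?_ ?_ ?_ ?_ ?_ ?_ <;> rw [dot4_comm]
    exacts [hνf p, hνfx p, hνfy p, hv, hνxf p, hne, hνxfy p, hνyf p, hνyfx p, hne']
  refine ⟨spanν ?_, spanν ?_, spanf ?_, spanf ?_⟩
  · linarith [hνxfy p]
  · rw [dot4_eq_dotProduct, sub_dotProduct, ← dot4_eq_dotProduct, ← dot4_eq_dotProduct]
    linarith [hdiag p]
  · linarith [hνyfx p]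
  · rw [dot4_eq_dotProduct, dotProduct_sub, ← dot4_eq_dotProduct, ← dot4_eq_dotProduct]
    linarith [hdiag p]
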